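/- arXiv:2210.00353 — 2 statements merged into one kernel-verified Lean document; each statement's English description precedes it below -/
import Mathlib

section
/- (Stability part of Lemma 1.) Suppose K > 0 and 0 ≤ u < u* := d/K. Then the neutral equilibrium Z = 0 of the belief dynamics is locally exponentially stable: there exist δ₀ > 0, M > 0, c > 0 such that every differentiable solution Z : [0, ∞) → ℝ^{N_a N_o} of the belief dynamics with ‖Z(0)‖ < δ₀ satisfies ‖Z(t)‖ ≤ M e^{−ct} ‖Z(0)‖ for all t ≥ 0. -/
open Matrix Complex

/-- The complex spectrum of a real square matrix: the set of complex roots of its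
characteristic polynomial. -/
noncomputable def specC {n : Type*} [Fintype n] [DecidableEq n]
    (M : Matrix n n ℝ) : Set ℂ :=
  {z : ℂ | ((M.map (Complex.ofReal)).charpoly).IsRoot z}

/-- The belief-formation vector field: component `(i, j)` of the right-hand side of the
belief dynamics, evaluated at the network state `Z`. -/
noncomputable def beliefField {Na No : ℕ}
    (Aa : Matrix (Fin Na) (Fin Na) ℝ) (Ao : Matrix (Fin No) (Fin No) ℝ)
    (d u α γ β δ : ℝ) (S₁ S₂ : ℝ → ℝ)
    (Z : Fin Na × Fin No → ℝ) : Fin Na × Fin No → ℝ :=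
  fun p =>
    -d * Z p + u * (S₁ (α * Z p + γ * ∑ k ∈ Finset.univ.erase p.1, Aa p.1 k * Z (k, p.2))
      + ∑ l ∈ Finset.univ.erase p.2,
          S₂ (β * Ao p.2 l * Z (p.1, l)
            + δ * Ao p.2 l * ∑ k ∈ Finset.univ.erase p.1, Aa p.1 k * Z (k, l)))

section Helpers
open scoped Matrix.Norms.Operator Topology
open Filter

/-- Matrix eigenvector extraction from the spectrum. -/
lemma exists_eigvec_of_mem_spectrum {ι : Type*} [Fintype ι] [DecidableEq ι]
    (A : Matrix ι ι ℂ) {z : ℂ} (hz : z ∈ spectrum ℂ A) :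
    ∃ v : ι → ℂ, v ≠ 0 ∧ A *ᵥ v = z • v := by
  rw [← Matrix.spectrum_toLin', ← Module.End.hasEigenvalue_iff_mem_spectrum] at hz
  obtain ⟨v, hv⟩ := hz.exists_hasEigenvector
  exact ⟨v, hv.2, by simpa using hv.apply_eq_smul⟩

lemma mem_specC_of_eigvec {ι : Type*} [Fintype ι] [DecidableEq ι]
    (A : Matrix ι ι ℝ) {z : ℂ} {v : ι → ℂ} (hv : v ≠ 0)
    (h : (A.map Complex.ofReal) *ᵥ v = z • v) : z ∈ specC A := by
  show Polynomial.eval z _ = 0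
  rw [Matrix.eval_charpoly, ← Matrix.exists_mulVec_eq_zero_iff]
  refine ⟨v, hv, ?_⟩
  rw [Matrix.sub_mulVec, h]
  ext i
  simp [Matrix.scalar_apply]

lemma norm_map_ofReal {ι : Type*} [Fintype ι] [DecidableEq ι] (A : Matrix ι ι ℝ) :
    ‖A.map Complex.ofReal‖ = ‖A‖ := by
  rw [Matrix.linfty_opNorm_def, Matrix.linfty_opNorm_def]
  simp

/-- An adapted norm for a Hurwitz matrix. -/
lemma exists_adapted_seminorm {ι : Type*} [Fintype ι] [DecidableEq ι]
    (L : Matrix ι ι ℝ)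
    (hL : ∀ (z : ℂ) (v : ι → ℂ), v ≠ 0 → (L.map Complex.ofReal) *ᵥ v = z • v → z.re < 0) :
    ∃ h > (0 : ℝ), ∃ r > (0 : ℝ), r < 1 ∧ ∃ C > (0 : ℝ), ∃ p : Seminorm ℝ (ι → ℝ),
      (∀ x, ‖x‖ ≤ p x) ∧ (∀ x, p x ≤ C * ‖x‖) ∧ ∀ x, p (x + h • (L *ᵥ x)) ≤ r * p x := by
  cases isEmpty_or_nonempty ι
  · refine ⟨1, one_pos, 1/2, by norm_num, by norm_num, 1, one_pos, 0, ?_, ?_, ?_⟩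
    · intro x; simp [Subsingleton.elim x 0]
    · intro x; simp [Subsingleton.elim x 0]
    · intro x; simp
  set A : Matrix ι ι ℂ := L.map Complex.ofReal with hA
  -- choose `h`
  obtain ⟨h, hpos, hh⟩ : ∃ h > (0 : ℝ), ∀ z ∈ spectrum ℂ A, ‖1 + (h : ℂ) * z‖ < 1 := by
    have hev : ∀ᶠ h : ℝ in 𝓝[>] (0 : ℝ), ∀ z ∈ spectrum ℂ A, ‖1 + (h : ℂ) * z‖ < 1 := by
      rw [eventually_all_finite A.finite_spectrum]
      intro z hz
      obtain ⟨v, hv, hvz⟩ := exists_eigvec_of_mem_spectrum A hz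
      have hre := hL z v hv hvz
      have hlim : Tendsto (fun h : ℝ => 2 * z.re + h * (z.re ^ 2 + z.im ^ 2)) (𝓝[>] 0)
          (𝓝 (2 * z.re + 0 * (z.re ^ 2 + z.im ^ 2))) := by
        apply Tendsto.mono_left _ nhdsWithin_le_nhds
        exact Continuous.tendsto (by fun_prop) 0
      have := hlim.eventually_lt_const (u := 0) (by linarith)
      filter_upwards [this, self_mem_nhdsWithin] with h h1 h2
      have h2 : 0 < h := h2
      have : ‖1 + (h : ℂ) * z‖ ^ 2 < 1 := by
        rw [Complex.sq_norm, Complex.normSq_apply]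
        simp
        nlinarith
      nlinarith [norm_nonneg (1 + (h : ℂ) * z)]
    obtain ⟨h, h1, h2⟩ := (hev.and self_mem_nhdsWithin).exists
    exact ⟨h, h2, h1⟩
  set B : Matrix ι ι ℝ := 1 + h • L with hB
  have hBA : B.map Complex.ofReal = 1 + (h : ℂ) • A := by
    ext i j
    simp [hB, hA, Matrix.one_apply]
    split_ifs <;> simp
  have hrad : spectralRadius ℂ (B.map Complex.ofReal) < (1 : NNReal) := by
    apply spectrum.spectralRadius_lt_of_forall_lt
    intro w hw
    rw [hBA] at hw
    obtain ⟨v, hv, hvw⟩ := exists_eigvec_of_mem_spectrum _ hw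
    have hAv : A *ᵥ v = ((w - 1) / h) • v := by
      rw [Matrix.add_mulVec, Matrix.one_mulVec, Matrix.smul_mulVec] at hvw
      have hne : (h : ℂ) ≠ 0 := by exact_mod_cast hpos.ne'
      ext i
      have := congrFun hvw i
      simp at this ⊢
      field_simp
      linear_combination this
    have hmem : (w - 1) / h ∈ spectrum ℂ A := by
      rw [← Matrix.spectrum_toLin', ← Module.End.hasEigenvalue_iff_mem_spectrum]
      exact Module.End.hasEigenvalue_of_hasEigenvector (x := v)
        ⟨Module.End.mem_eigenspace_iff.2 (by simpa using hAv), hv⟩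
    have := hh _ hmem
    have hne : (h : ℂ) ≠ 0 := by exact_mod_cast hpos.ne'
    rw [mul_div_cancel₀ _ hne] at this
    have : ‖w‖ < 1 := by simpa using this
    exact_mod_cast this
  obtain ⟨r, hr1, hr2⟩ := ENNReal.lt_iff_exists_nnreal_btwn.1 hrad
  have hr2 : (r : ℝ) < 1 := by exact_mod_cast hr2
  have hr0 : (0 : ℝ) < r := by
    have : 0 < r := by
      have := lt_of_le_of_lt zero_le hr1
      exact_mod_cast this
    exact_mod_cast this
  obtain ⟨N, hN, hNr⟩ : ∃ N : ℕ, 0 < N ∧ ‖B ^ N‖ ≤ (r : ℝ) ^ N := by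
    have hg := spectrum.pow_norm_pow_one_div_tendsto_nhds_spectralRadius (B.map Complex.ofReal)
    obtain ⟨N, h1, h2⟩ := ((hg.eventually_lt_const hr1).and (eventually_gt_atTop 0)).exists
    refine ⟨N, h2, ?_⟩
    have hpow : (B.map Complex.ofReal) ^ N = (B ^ N).map Complex.ofReal :=
      (map_pow (Complex.ofRealHom.mapMatrix (m := ι)) B N).symm
    rw [hpow, norm_map_ofReal] at h1
    have h3 : ‖B ^ N‖ ^ (1 / N : ℝ) ≤ r := by
      have h5 : ENNReal.ofReal (‖B ^ N‖ ^ (1 / N : ℝ)) < ENNReal.ofReal (r : ℝ) := by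
        simpa using h1
      exact ((ENNReal.ofReal_lt_ofReal_iff hr0).1 h5).le
    have h4 := pow_le_pow_left₀ (by positivity) h3 N
    rwa [one_div, Real.rpow_inv_natCast_pow (norm_nonneg _) h2.ne'] at h4
  let f : (ι → ℝ) → ℝ := fun x => ∑ n ∈ Finset.range N, ((r : ℝ) ^ n)⁻¹ * ‖(B ^ n) *ᵥ x‖
  let p : Seminorm ℝ (ι → ℝ) := Seminorm.of f
    (by
      intro x y
      simp only [f]
      rw [← Finset.sum_add_distrib]
      apply Finset.sum_le_sum
      intro n _
      rw [Matrix.mulVec_add, ← mul_add]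
      gcongr
      exact norm_add_le _ _)
    (by
      intro a x
      simp only [f]
      rw [Finset.mul_sum]
      apply Finset.sum_congr rfl
      intro n _
      rw [Matrix.mulVec_smul, norm_smul]
      ring)
  have hp : ∀ x, p x = f x := fun x => rfl
  refine ⟨h, hpos, r, hr0, hr2, 1 + ∑ n ∈ Finset.range N, ((r : ℝ) ^ n)⁻¹ * ‖B ^ n‖,
    by positivity, p, ?_, ?_, ?_⟩
  · intro x
    rw [hp]
    have := Finset.single_le_sum (f := fun n => ((r : ℝ) ^ n)⁻¹ * ‖(B ^ n) *ᵥ x‖)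
      (s := Finset.range N) (fun n _ => by positivity) (Finset.mem_range.2 hN)
    simpa using this
  · intro x
    rw [hp, add_mul, Finset.sum_mul]
    have : f x ≤ ∑ n ∈ Finset.range N, ((r : ℝ) ^ n)⁻¹ * ‖B ^ n‖ * ‖x‖ := by
      apply Finset.sum_le_sum
      intro n _
      rw [mul_assoc]
      gcongr
      exact Matrix.linfty_opNorm_mulVec _ _
    linarith [norm_nonneg x]
  · intro x
    have hx : x + h • (L *ᵥ x) = B *ᵥ x := by
      rw [hB, Matrix.add_mulVec, Matrix.one_mulVec, Matrix.smul_mulVec]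
    rw [hx, hp, hp]
    let g : ℕ → ℝ := fun n => ((r : ℝ) ^ n)⁻¹ * ‖(B ^ n) *ᵥ x‖
    have e1 : f (B *ᵥ x) = r * ∑ n ∈ Finset.range N, g (n + 1) := by
      simp only [f, g]
      rw [Finset.mul_sum]
      apply Finset.sum_congr rfl
      intro n _
      rw [Matrix.mulVec_mulVec, ← pow_succ, pow_succ (r : ℝ)]
      field_simp
    have e2 : f x = ∑ n ∈ Finset.range N, g n := rfl
    rw [e1, e2]
    gcongr ?_ * ?_
    have e3 := Finset.sum_range_succ g N
    have e4 := Finset.sum_range_succ' g N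
    have e5 : g N ≤ g 0 := by
      simp only [g, pow_zero, inv_one, one_mul, Matrix.one_mulVec]
      rw [inv_mul_le_iff₀ (by positivity)]
      exact (Matrix.linfty_opNorm_mulVec _ _).trans (by gcongr)
    linarith

/-- Linearized stability. -/
lemma stable_of_linearization {ι : Type*} [Fintype ι] [DecidableEq ι]
    (L : Matrix ι ι ℝ)
    (hL : ∀ (z : ℂ) (v : ι → ℂ), v ≠ 0 → (L.map Complex.ofReal) *ᵥ v = z • v → z.re < 0)
    (F : (ι → ℝ) → (ι → ℝ))
    (hF : ∀ ε > (0 : ℝ), ∃ η > (0 : ℝ), ∀ x, ‖x‖ < η → ‖F x - L *ᵥ x‖ ≤ ε * ‖x‖) :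
    ∃ δ₀ > (0 : ℝ), ∃ M > (0 : ℝ), ∃ c > (0 : ℝ),
      ∀ Z : ℝ → (ι → ℝ), (∀ t : ℝ, 0 ≤ t → HasDerivAt Z (F (Z t)) t) →
        ‖Z 0‖ < δ₀ → ∀ t : ℝ, 0 ≤ t → ‖Z t‖ ≤ M * Real.exp (-c * t) * ‖Z 0‖ := by
  obtain ⟨h, hpos, r, hr0, hr1, C, hC, p, hp1, hp2, hp3⟩ := exists_adapted_seminorm L hL
  set c : ℝ := (1 - r) / (2 * h) with hc
  have hcpos : 0 < c := div_pos (by linarith) (by positivity)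
  obtain ⟨η, hη, hFη⟩ := hF (c / (2 * C)) (by positivity)
  refine ⟨η / C, by positivity, C, hC, c, hcpos, ?_⟩
  intro Z hZ hZ0 t ht
  -- decay estimate at each point
  have hdecay : ∀ x : ι → ℝ, ‖x‖ < η → 0 < p x →
      (p (x + h • F x) - p x) / h < -c * p x := by
    intro x hx hpx
    have e1 : x + h • F x = (x + h • (L *ᵥ x)) + h • (F x - L *ᵥ x) := by
      rw [smul_sub]; abel
    have e2 : p (x + h • F x) ≤ r * p x + h * (C * (c / (2 * C) * p x)) := by
      rw [e1]
      refine (map_add_le_add p _ _).trans (add_le_add (hp3 x) ?_)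
      rw [map_smul_eq_mul, Real.norm_of_nonneg hpos.le]
      gcongr
      refine (hp2 _).trans ?_
      gcongr
      refine (hFη x hx).trans ?_
      gcongr
      exact hp1 x
    have e3 : C * (c / (2 * C) * p x) = c / 2 * p x := by field_simp
    have e4 : 1 - r = 2 * h * c := by rw [hc]; field_simp
    rw [e3] at e2
    rw [div_lt_iff₀ hpos]
    have : r = 1 - 2 * h * c := by linarith
    rw [this] at e2
    have : 0 < h * c * p x := by positivity
    nlinarith
  have hcont : Continuous p := by
    refine Seminorm.continuous_of_le (q := (C.toNNReal) • normSeminorm ℝ (ι → ℝ)) ?_ ?_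
    · exact (continuous_norm.const_smul (C.toNNReal))
    · intro x
      have := hp2 x
      simpa [NNReal.smul_def, Real.coe_toNNReal _ hC.le] using this
  -- slope estimate
  have hslope : ∀ x : ℝ, 0 ≤ x → ∀ ρ, (p (Z x + h • F (Z x)) - p (Z x)) / h < ρ →
      ∃ᶠ z in 𝓝[>] x, slope (fun s => p (Z s)) x z < ρ := by
    intro x hx ρ hρ
    apply Eventually.frequently
    set κ := (ρ - (p (Z x + h • F (Z x)) - p (Z x)) / h) / (2 * C) with hκ
    have hκpos : 0 < κ := div_pos (by linarith) (by positivity)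
    have hd := (hasDerivAt_iff_isLittleO.1 (hZ x hx)).def hκpos
    have hd' := hd.filter_mono (nhdsWithin_le_nhds (s := Set.Ioi x))
    have hlt : ∀ᶠ z in 𝓝[>] x, z < x + h :=
      (eventually_lt_nhds (by linarith)).filter_mono nhdsWithin_le_nhds
    filter_upwards [hd', hlt, self_mem_nhdsWithin] with z h1 h2 h3
    have h3 : 0 < z - x := sub_pos.2 h3
    set s := z - x with hs
    rw [slope_def_field, div_lt_iff₀ h3]
    have e1 : Z z = ((1 - s / h) • Z x + (s / h) • (Z x + h • F (Z x)))
        + (Z z - Z x - s • F (Z x)) := by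
      ext i
      simp
      field_simp
      ring
    have hsh : s / h ≤ 1 := by rw [div_le_one hpos]; linarith
    have e2 : p (Z z) ≤ (1 - s / h) * p (Z x) + (s / h) * p (Z x + h • F (Z x))
        + C * (κ * s) := by
      rw [e1]
      refine (map_add_le_add p _ _).trans (add_le_add ?_ ?_)
      · refine (map_add_le_add p _ _).trans (le_of_eq ?_)
        rw [map_smul_eq_mul, map_smul_eq_mul, Real.norm_of_nonneg (by linarith),
          Real.norm_of_nonneg (by positivity)]
      · refine (hp2 _).trans ?_
        gcongr
        simpa [abs_of_pos h3] using h1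
    set D := (p (Z x + h • F (Z x)) - p (Z x)) / h with hD
    have e3 : p (Z x + h • F (Z x)) = p (Z x) + h * D := by rw [hD]; field_simp; ring
    have e4 : C * (κ * s) = (ρ - D) / 2 * s := by rw [hκ]; field_simp
    rw [e3, e4] at e2
    have e5 : (1 - s / h) * p (Z x) + s / h * (p (Z x) + h * D) = p (Z x) + s * D := by
      field_simp; ring
    rw [e5] at e2
    have : 0 < (ρ - D) * s := mul_pos (by linarith) h3
    nlinarith
  have hZc : ContinuousOn (fun s => p (Z s)) (Set.Icc 0 t) := by
    intro s hs
    exact (hcont.continuousAt.comp (hZ s hs.1).continuousAt).continuousWithinAt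
  have hp0 : p (Z 0) < η := by
    refine (hp2 _).trans_lt ?_
    rwa [lt_div_iff₀' hC] at hZ0
  have key : ∀ b, p (Z 0) < b → b < η → p (Z t) ≤ b * Real.exp (-c * t) := by
    intro b hb1 hb2
    have hb0 : 0 < b := (apply_nonneg p _).trans_lt hb1
    refine image_le_of_liminf_slope_right_lt_deriv_boundary (a := 0) (b := t)
      (f := fun s => p (Z s))
      (f' := fun x => (p (Z x + h • F (Z x)) - p (Z x)) / h)
      (B := fun s => b * Real.exp (-c * s)) (B' := fun s => -c * (b * Real.exp (-c * s)))
      hZc (fun x hx => hslope x hx.1) (by simpa using hb1.le) ?_ ?_ ⟨ht, le_rfl⟩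
    · intro x
      have := (((hasDerivAt_id x).const_mul (-c)).exp).const_mul b
      convert! this using 1
      simp; ring
    · intro x hx hxe
      have hxe : p (Z x) = b * Real.exp (-c * x) := hxe
      rw [← hxe]
      apply hdecay
      · refine (hp1 _).trans_lt ?_
        rw [hxe]
        have : Real.exp (-c * x) ≤ 1 := Real.exp_le_one_iff.2 (by nlinarith [hx.1])
        nlinarith
      · rw [hxe]; positivity
  have hfin : p (Z t) ≤ p (Z 0) * Real.exp (-c * t) := by
    have hlim : Tendsto (fun b : ℝ => b * Real.exp (-c * t)) (𝓝[>] (p (Z 0)))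
        (𝓝 (p (Z 0) * Real.exp (-c * t))) :=
      (Continuous.tendsto (by fun_prop) _).mono_left nhdsWithin_le_nhds
    refine ge_of_tendsto hlim ?_
    have : ∀ᶠ b in 𝓝[>] (p (Z 0)), b < η :=
      (eventually_lt_nhds hp0).filter_mono nhdsWithin_le_nhds
    filter_upwards [this, self_mem_nhdsWithin] with b h1 h2
    exact key b h2 h1
  calc ‖Z t‖ ≤ p (Z t) := hp1 _
    _ ≤ p (Z 0) * Real.exp (-c * t) := hfin
    _ ≤ (C * ‖Z 0‖) * Real.exp (-c * t) := by gcongr; exact hp2 _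
    _ = _ := by ring

/-- An invariant nonzero subspace contains an eigenvector. -/
lemma exists_eigvec_in_invariant {V : Type*} [AddCommGroup V] [Module ℂ V]
    [FiniteDimensional ℂ V] (T : Module.End ℂ V) (W : Submodule ℂ V) (hW : W ≠ ⊥)
    (hT : ∀ x ∈ W, T x ∈ W) : ∃ μ : ℂ, ∃ v ∈ W, v ≠ 0 ∧ T v = μ • v := by
  have : Nontrivial W := Submodule.nontrivial_iff_ne_bot.2 hW
  obtain ⟨μ, hμ⟩ := Module.End.exists_eigenvalue (T.restrict hT)
  obtain ⟨v, hv⟩ := hμ.exists_hasEigenvector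
  refine ⟨μ, v, v.2, fun h => hv.2 (Subtype.ext h), ?_⟩
  have := congrArg Subtype.val hv.apply_eq_smul
  simpa using this

lemma kron_mulVec_apply {R m n : Type*} [CommRing R] [Fintype m] [Fintype n]
    (A : Matrix m m R) (B : Matrix n n R) (x : m × n → R) (i : m) (j : n) :
    ((Matrix.kroneckerMap (· * ·) A B) *ᵥ x) (i, j) =
      ∑ k, ∑ l, A i k * B j l * x (k, l) := by
  simp [Matrix.mulVec, dotProduct, Fintype.sum_prod_type]

lemma kron_one_mulVec_apply {R m n : Type*} [CommRing R] [Fintype m] [Fintype n]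
    [DecidableEq n]
    (A : Matrix m m R) (x : m × n → R) (i : m) (j : n) :
    ((Matrix.kroneckerMap (· * ·) A (1 : Matrix n n R)) *ᵥ x) (i, j) =
      ∑ k, A i k * x (k, j) := by
  rw [kron_mulVec_apply]
  simp [Matrix.one_apply]

lemma one_kron_mulVec_apply {R m n : Type*} [CommRing R] [Fintype m] [Fintype n]
    [DecidableEq m]
    (B : Matrix n n R) (x : m × n → R) (i : m) (j : n) :
    ((Matrix.kroneckerMap (· * ·) (1 : Matrix m m R) B) *ᵥ x) (i, j) =
      ∑ l, B j l * x (i, l) := by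
  rw [kron_mulVec_apply]
  simp [Matrix.one_apply]

/-- The Jacobian at the origin. -/
noncomputable def jac {m n : Type*} [Fintype m] [Fintype n] [DecidableEq m] [DecidableEq n]
    {R : Type*} [CommRing R]
    (A : Matrix m m R) (B : Matrix n n R) (d u α γ β δ : R) : Matrix (m × n) (m × n) R :=
  (-d + u * α) • (1 : Matrix (m × n) (m × n) R)
    + (u * γ) • Matrix.kroneckerMap (· * ·) A (1 : Matrix n n R)
    + (u * β) • Matrix.kroneckerMap (· * ·) (1 : Matrix m m R) B
    + (u * δ) • Matrix.kroneckerMap (· * ·) A B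

lemma jac_map {m n : Type*} [Fintype m] [Fintype n] [DecidableEq m] [DecidableEq n]
    (A : Matrix m m ℝ) (B : Matrix n n ℝ) (d u α γ β δ : ℝ) :
    (jac A B d u α γ β δ).map Complex.ofReal =
      jac (A.map Complex.ofReal) (B.map Complex.ofReal) (d : ℂ) u α γ β δ := by
  ext p q
  simp [jac, Matrix.one_apply, apply_ite Complex.ofReal]

lemma jac_eigenvalue {m n : Type*} [Fintype m] [Fintype n] [DecidableEq m] [DecidableEq n]
    (A : Matrix m m ℝ) (B : Matrix n n ℝ) (d u α γ β δ : ℝ) (z : ℂ) (v : m × n → ℂ)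
    (hv : v ≠ 0) (h : ((jac A B d u α γ β δ).map Complex.ofReal) *ᵥ v = z • v) :
    ∃ l ∈ specC A, ∃ k ∈ specC B, z = -d + u * ((α : ℂ) + γ * l + β * k + δ * l * k) := by
  rw [jac_map] at h
  set A' := A.map Complex.ofReal with hA'
  set B' := B.map Complex.ofReal with hB'
  set P : Matrix (m × n) (m × n) ℂ := Matrix.kroneckerMap (· * ·) A' (1 : Matrix n n ℂ) with hP
  set Q : Matrix (m × n) (m × n) ℂ := Matrix.kroneckerMap (· * ·) (1 : Matrix m m ℂ) B' with hQ
  have hPQ : P * Q = Matrix.kroneckerMap (· * ·) A' B' := by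
    have := Matrix.mul_kronecker_mul A' (1 : Matrix m m ℂ) (1 : Matrix n n ℂ) B'
    simp only [mul_one, one_mul] at this
    exact this.symm
  have hQP : Q * P = Matrix.kroneckerMap (· * ·) A' B' := by
    have := Matrix.mul_kronecker_mul (1 : Matrix m m ℂ) A' B' (1 : Matrix n n ℂ)
    simp only [mul_one, one_mul] at this
    exact this.symm
  set J := jac A' B' (d : ℂ) u α γ β δ with hJ
  have hJ' : J = (-(d : ℂ) + u * α) • (1 : Matrix (m × n) (m × n) ℂ) + ((u : ℂ) * γ) • P
      + ((u : ℂ) * β) • Q + ((u : ℂ) * δ) • (P * Q) := by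
    rw [hPQ]; rfl
  have hcomm : Commute P Q := by
    show P * Q = Q * P
    rw [hPQ, hQP]
  have hJP : Commute J P := by
    rw [hJ']
    refine Commute.add_left (Commute.add_left (Commute.add_left ?_ ?_) ?_) ?_
    · exact (Commute.one_left P).smul_left _
    · exact (Commute.refl P).smul_left _
    · exact hcomm.symm.smul_left _
    · exact ((Commute.refl P).mul_left hcomm.symm).smul_left _
  have hJQ : Commute J Q := by
    rw [hJ']
    refine Commute.add_left (Commute.add_left (Commute.add_left ?_ ?_) ?_) ?_
    · exact (Commute.one_left Q).smul_left _
    · exact hcomm.smul_left _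
    · exact (Commute.refl Q).smul_left _
    · exact (hcomm.mul_left (Commute.refl Q)).smul_left _
  have hinv : ∀ {X Y : Matrix (m × n) (m × n) ℂ} (_ : Commute X Y) (w : ℂ) (x : m × n → ℂ),
      X *ᵥ x = w • x → X *ᵥ (Y *ᵥ x) = w • (Y *ᵥ x) := by
    intro X Y hXY w x hx
    rw [Matrix.mulVec_mulVec, hXY.eq, ← Matrix.mulVec_mulVec, hx, Matrix.mulVec_smul]
  have hmem : ∀ (X : Matrix (m × n) (m × n) ℂ) (w : ℂ) (x : m × n → ℂ),
      x ∈ Module.End.eigenspace (Matrix.toLin' X) w ↔ X *ᵥ x = w • x := by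
    intro X w x
    rw [Module.End.mem_eigenspace_iff, Matrix.toLin'_apply]
  obtain ⟨l, x, hxW, hx0, hxl⟩ := exists_eigvec_in_invariant (Matrix.toLin' P)
    (Module.End.eigenspace (Matrix.toLin' J) z)
    (by
      rw [Submodule.ne_bot_iff]
      exact ⟨v, (hmem _ _ _).2 h, hv⟩)
    (by
      intro x hx
      rw [hmem] at hx ⊢
      exact hinv hJP z x hx)
  rw [Matrix.toLin'_apply] at hxl
  obtain ⟨k, y, hyW, hy0, hyk⟩ := exists_eigvec_in_invariant (Matrix.toLin' Q)
    (Module.End.eigenspace (Matrix.toLin' J) z ⊓ Module.End.eigenspace (Matrix.toLin' P) l)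
    (by
      rw [Submodule.ne_bot_iff]
      exact ⟨x, ⟨hxW, (hmem _ _ _).2 hxl⟩, hx0⟩)
    (by
      rintro x ⟨hx1, hx2⟩
      rw [SetLike.mem_coe, hmem] at hx1 hx2
      exact ⟨(hmem _ _ _).2 (hinv hJQ z x hx1), (hmem _ _ _).2 (hinv hcomm l x hx2)⟩)
  rw [Matrix.toLin'_apply] at hyk
  obtain ⟨hyJ, hyl⟩ := hyW
  rw [SetLike.mem_coe, hmem] at hyJ hyl
  obtain ⟨⟨i, j⟩, hij⟩ := Function.ne_iff.1 hy0
  refine ⟨l, ?_, k, ?_, ?_⟩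
  · refine mem_specC_of_eigvec A (v := fun i' => y (i', j)) (fun h0 => hij (congrFun h0 i)) ?_
    ext i'
    have := congrFun hyl (i', j)
    rw [hP, kron_one_mulVec_apply] at this
    simpa [Matrix.mulVec, dotProduct, hA'] using this
  · refine mem_specC_of_eigvec B (v := fun j' => y (i, j')) (fun h0 => hij (congrFun h0 j)) ?_
    ext j'
    have := congrFun hyk (i, j')
    rw [hQ, one_kron_mulVec_apply] at this
    simpa [Matrix.mulVec, dotProduct, hB'] using this
  · have e : J *ᵥ y = (-(d : ℂ) + u * ((α : ℂ) + γ * l + β * k + δ * l * k)) • y := by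
      rw [hJ']
      simp only [Matrix.add_mulVec, Matrix.smul_mulVec, Matrix.one_mulVec,
        ← Matrix.mulVec_mulVec, hyk, hyl, Matrix.mulVec_smul]
      ext q
      simp
      ring
    rw [hyJ] at e
    have := congrFun e (i, j)
    simp only [Pi.smul_apply, smul_eq_mul] at this
    exact mul_right_cancel₀ hij this

lemma sigmoid_littleO {E : Type*} [NormedAddCommGroup E] [NormedSpace ℝ E]
    (S : ℝ → ℝ) (hS : ContDiff ℝ 1 S) (h0 : S 0 = 0) (h1 : deriv S 0 = 1)
    (ℓ : E → ℝ) (hℓ : DifferentiableAt ℝ ℓ 0) (hℓ0 : ℓ 0 = 0) :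
    (fun x => S (ℓ x) - ℓ x) =o[𝓝 (0 : E)] (fun x => x) := by
  have hd : HasDerivAt S 1 0 := by
    rw [← h1]
    exact (hS.differentiable one_ne_zero).differentiableAt.hasDerivAt
  have ho : (fun y : ℝ => S y - y) =o[𝓝 (0 : ℝ)] (fun y => y) := by
    simpa [h0] using hasDerivAt_iff_isLittleO.1 hd
  have ht : Tendsto ℓ (𝓝 0) (𝓝 0) := by
    have := hℓ.continuousAt.tendsto
    rwa [hℓ0] at this
  have hO : ℓ =O[𝓝 (0 : E)] (fun x => x) := by
    simpa [hℓ0] using hℓ.isBigO_sub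
  exact (ho.comp_tendsto ht).trans_isBigO hO

lemma belief_littleO {Na No : ℕ}
    (Aa : Matrix (Fin Na) (Fin Na) ℝ) (Ao : Matrix (Fin No) (Fin No) ℝ)
    (hAa : ∀ i, Aa i i = 0) (hAo : ∀ j, Ao j j = 0)
    (d u α γ β δ : ℝ) (S₁ S₂ : ℝ → ℝ)
    (hS₁ : ContDiff ℝ 1 S₁) (hS₂ : ContDiff ℝ 1 S₂)
    (hS₁0 : S₁ 0 = 0) (hS₂0 : S₂ 0 = 0)
    (hS₁1 : deriv S₁ 0 = 1) (hS₂1 : deriv S₂ 0 = 1) :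
    (fun Z => beliefField Aa Ao d u α γ β δ S₁ S₂ Z - jac Aa Ao d u α γ β δ *ᵥ Z)
      =o[𝓝 (0 : Fin Na × Fin No → ℝ)] (fun Z => Z) := by
  rw [Asymptotics.isLittleO_pi]
  rintro ⟨i, j⟩
  have e : (fun Z : Fin Na × Fin No → ℝ =>
      (beliefField Aa Ao d u α γ β δ S₁ S₂ Z - jac Aa Ao d u α γ β δ *ᵥ Z) (i, j)) =
      fun Z => u * ((S₁ (α * Z (i, j) + γ * ∑ k, Aa i k * Z (k, j))
          - (α * Z (i, j) + γ * ∑ k, Aa i k * Z (k, j)))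
        + ∑ l ∈ Finset.univ.erase j,
          (S₂ (β * Ao j l * Z (i, l) + δ * Ao j l * ∑ k, Aa i k * Z (k, l))
            - (β * Ao j l * Z (i, l) + δ * Ao j l * ∑ k, Aa i k * Z (k, l)))) := by
    funext Z
    have h1 : ∀ l, ∑ k ∈ Finset.univ.erase i, Aa i k * Z (k, l) = ∑ k, Aa i k * Z (k, l) :=
      fun l => Finset.sum_erase _ (by simp [hAa])
    have h2 : ∑ l ∈ Finset.univ.erase j,
        (β * Ao j l * Z (i, l) + δ * Ao j l * ∑ k, Aa i k * Z (k, l)) =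
        β * ∑ l, Ao j l * Z (i, l) + δ * ∑ k, ∑ l, Aa i k * Ao j l * Z (k, l) := by
      rw [Finset.sum_erase _ (by simp [hAo]), Finset.sum_add_distrib, Finset.sum_comm,
        Finset.mul_sum, Finset.mul_sum]
      congr 1
      · exact Finset.sum_congr rfl fun l _ => by ring
      · refine Finset.sum_congr rfl fun l _ => ?_
        rw [Finset.mul_sum, Finset.mul_sum]
        exact Finset.sum_congr rfl fun k _ => by ring
    have h3 : (jac Aa Ao d u α γ β δ *ᵥ Z) (i, j) = (-d + u * α) * Z (i, j)
        + u * γ * ∑ k, Aa i k * Z (k, j) + u * β * ∑ l, Ao j l * Z (i, l)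
        + u * δ * ∑ k, ∑ l, Aa i k * Ao j l * Z (k, l) := by
      simp only [jac, Matrix.add_mulVec, Matrix.smul_mulVec, Matrix.one_mulVec, Pi.add_apply,
        Pi.smul_apply, smul_eq_mul, kron_one_mulVec_apply, one_kron_mulVec_apply]
      rw [kron_mulVec_apply]
    rw [Pi.sub_apply, h3, Finset.sum_sub_distrib, h2]
    simp only [beliefField, h1]
    ring
  rw [e]
  refine Asymptotics.IsLittleO.const_mul_left ?_ u
  refine Asymptotics.IsLittleO.add ?_ (Asymptotics.IsLittleO.fun_sum fun l _ => ?_)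
  · exact sigmoid_littleO S₁ hS₁ hS₁0 hS₁1
      (fun Z : Fin Na × Fin No → ℝ => α * Z (i, j) + γ * ∑ k, Aa i k * Z (k, j))
      (by fun_prop) (by simp)
  · exact sigmoid_littleO S₂ hS₂ hS₂0 hS₂1
      (fun Z : Fin Na × Fin No → ℝ =>
        β * Ao j l * Z (i, l) + δ * Ao j l * ∑ k, Aa i k * Z (k, l))
      (by fun_prop) (by simp)

end Helpers

/-- Stability part of Lemma 1: if `K > 0` and `0 ≤ u < u* = d/K`, the neutral
equilibrium `Z = 0` of the belief dynamics is locally exponentially stable. -/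
theorem origin_locally_exponentially_stable {Na No : ℕ} (hNa : 1 ≤ Na) (hNo : 1 ≤ No)
    (Aa : Matrix (Fin Na) (Fin Na) ℝ) (Ao : Matrix (Fin No) (Fin No) ℝ)
    (hAa : ∀ i, Aa i i = 0) (hAo : ∀ j, Ao j j = 0)
    (d u α γ β δ K : ℝ) (hd : 0 < d) (hu : 0 ≤ u)
    (S₁ S₂ : ℝ → ℝ)
    (hS₁smooth : ContDiff ℝ 1 S₁) (hS₂smooth : ContDiff ℝ 1 S₂)
    (hS₁bdd : ∃ C, ∀ x, |S₁ x| ≤ C) (hS₂bdd : ∃ C, ∀ x, |S₂ x| ≤ C)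
    (hS₁dbdd : ∃ C, ∀ x, |deriv S₁ x| ≤ C) (hS₂dbdd : ∃ C, ∀ x, |deriv S₂ x| ≤ C)
    (hS₁0 : S₁ 0 = 0) (hS₂0 : S₂ 0 = 0)
    (hS₁1 : deriv S₁ 0 = 1) (hS₂1 : deriv S₂ 0 = 1)
    (hK : IsGreatest {x : ℝ | ∃ l ∈ specC Aa, ∃ m ∈ specC Ao,
        x = ((α : ℂ) + (γ : ℂ) * l + (β : ℂ) * m + (δ : ℂ) * l * m).re} K)
    (hKpos : 0 < K) (hu' : u < d / K) :
    ∃ δ₀ > (0 : ℝ), ∃ M > (0 : ℝ), ∃ c > (0 : ℝ),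
      ∀ Z : ℝ → (Fin Na × Fin No → ℝ),
        (∀ t : ℝ, 0 ≤ t → HasDerivAt Z (beliefField Aa Ao d u α γ β δ S₁ S₂ (Z t)) t) →
        ‖Z 0‖ < δ₀ →
        ∀ t : ℝ, 0 ≤ t → ‖Z t‖ ≤ M * Real.exp (-c * t) * ‖Z 0‖ := by
  refine stable_of_linearization (jac Aa Ao d u α γ β δ) ?_ _ ?_
  · intro z v hv hz
    obtain ⟨l, hl, k, hk, rfl⟩ := jac_eigenvalue Aa Ao d u α γ β δ z v hv hz
    have hle := hK.2 ⟨l, hl, k, hk, rfl⟩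
    have hlt : u * K < d := (lt_div_iff₀ hKpos).1 hu'
    have hre : (-(d : ℂ) + u * ((α : ℂ) + γ * l + β * k + δ * l * k)).re
        = -d + u * ((α : ℂ) + γ * l + β * k + δ * l * k).re := by
      rw [Complex.add_re, Complex.re_ofReal_mul, Complex.neg_re, Complex.ofReal_re]
    rw [hre]
    nlinarith [mul_le_mul_of_nonneg_left hle hu]
  · intro ε hε
    have ho := (belief_littleO Aa Ao hAa hAo d u α γ β δ S₁ S₂ hS₁smooth hS₂smooth
      hS₁0 hS₂0 hS₁1 hS₂1).def hε
    obtain ⟨η, hη, hb⟩ := Metric.eventually_nhds_iff.1 ho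
    exact ⟨η, hη, fun x hx => hb (by simpa using hx)⟩
end

section
/- (Instability part of Lemma 1.) Suppose K > 0 and u > u* := d/K. Then the neutral equilibrium Z = 0 of the belief dynamics is unstable: there exists ε > 0 such that for every δ > 0 there is a differentiable solution Z : [0, ∞) → ℝ^{N_a N_o} of the belief dynamics with ‖Z(0)‖ < δ and a time t ≥ 0 with ‖Z(t)‖ ≥ ε. -/
open Matrix Complex

theorem global_sol {E : Type*} [NormedAddCommGroup E] [NormedSpace ℝ E] [CompleteSpace E]
    (F : E → E) (hF : ContDiff ℝ 1 F) (K : NNReal) (hL : LipschitzWith K F) (h0 : F 0 = 0)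
    (x : E) : ∃ Z : ℝ → E, Z 0 = x ∧ ∀ t, HasDerivAt Z (F (Z t)) t := by
  have hε : (0 : ℝ) < 1 / (2 * ((K : ℝ) + 1)) := by positivity
  set ε : ℝ := 1 / (2 * ((K : ℝ) + 1)) with hεdef
  have hv : ContMDiff (modelWithCornersSelf ℝ E) (modelWithCornersSelf ℝ E).tangent 1
      (fun x ↦ (⟨x, F x⟩ : TangentBundle (modelWithCornersSelf ℝ E) E)) :=
    contMDiff_vectorSpace_iff_contDiff.2 hF
  obtain ⟨Z, hZ0, hZ⟩ := exists_isMIntegralCurve_of_isMIntegralCurveOn hv hε (by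
    intro x
    have hpl : IsPicardLindelof (fun _ ↦ F) (tmin := -ε) (tmax := ε)
        ⟨0, by constructor <;> linarith⟩ x (‖x‖₊ + 1) 0 (2 * (K + 1) * (‖x‖₊ + 1)) K := by
      apply IsPicardLindelof.of_time_independent
      · intro y hy
        have h1 : ‖F y‖ ≤ K * ‖y‖ := by
          have := hL.norm_sub_le y 0
          simpa [h0] using this
        have h2 : ‖y‖ ≤ 2 * (‖x‖ + 1) := by
          have := norm_le_norm_add_norm_sub' y x
          have h3 : ‖y - x‖ ≤ ‖x‖ + 1 := by simpa [dist_eq_norm] using hy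
          linarith
        push_cast
        have hK : (0:ℝ) ≤ K := K.2
        calc ‖F y‖ ≤ K * ‖y‖ := h1
          _ ≤ (K + 1) * (2 * (‖x‖ + 1)) := by gcongr; linarith
          _ = _ := by ring
      · exact hL.lipschitzOnWith
      · have hK : (0:ℝ) < K + 1 := by positivity
        simp only [sub_zero, zero_sub, neg_neg, max_self]
        push_cast
        rw [hεdef]
        apply le_of_eq
        field_simp
        simp
    obtain ⟨α, h1, h2⟩ := hpl.exists_eq_forall_mem_Icc_hasDerivWithinAt₀
    refine ⟨α, h1, fun t ht => ?_⟩
    have := (h2 t (Set.Ioo_subset_Icc_self ht)).mono Set.Ioo_subset_Icc_self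
    exact this.hasFDerivWithinAt.hasMFDerivWithinAt) x
  refine ⟨Z, hZ0, fun t => ?_⟩
  have h : HasFDerivAt Z ((1 : ℝ →L[ℝ] ℝ).smulRight (F (Z t)) : ℝ →L[ℝ] E) t :=
    (hZ t).hasFDerivAt
  simpa using h.hasDerivAt


theorem lyap_arith {κ C a b E N m X : ℝ} (hκ : 0 < κ) (hX0 : 0 ≤ X)
    (hX : X ≤ b + a * E) (hN : N * m = C ^ 2 / (2 * κ) + 1) :
    min (κ / 4) (1 / (2 * (E ^ 2 + 1))) * X ^ 2 ≤ κ * b ^ 2 - C * a * b + N * m * a ^ 2 := by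
  set k := min (κ / 4) (1 / (2 * (E ^ 2 + 1))) with hk
  have hk0 : 0 ≤ k := by positivity
  have hk1 : k ≤ κ / 4 := min_le_left _ _
  have hk2 : k * (2 * (E ^ 2 + 1)) ≤ 1 := by
    have : k ≤ 1 / (2 * (E ^ 2 + 1)) := min_le_right _ _
    rwa [le_div_iff₀ (by positivity)] at this
  have h1 : X ^ 2 ≤ 2 * b ^ 2 + 2 * (a ^ 2 * E ^ 2) := by
    have : X ^ 2 ≤ (b + a * E) ^ 2 := by gcongr
    nlinarith [sq_nonneg (b - a * E)]
  have h2 : κ / 2 * b ^ 2 - C * a * b + C ^ 2 / (2 * κ) * a ^ 2 = (κ * b - C * a) ^ 2 / (2 * κ) := by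
    field_simp; ring
  have h3 : 0 ≤ (κ * b - C * a) ^ 2 / (2 * κ) := by positivity
  rw [hN]
  have h4 : k * X ^ 2 ≤ k * (2 * b ^ 2 + 2 * (a ^ 2 * E ^ 2)) := by gcongr
  have h5 : k * b ^ 2 ≤ κ / 4 * b ^ 2 := by gcongr
  have h6 : k * (2 * (E ^ 2 + 1)) * a ^ 2 ≤ 1 * a ^ 2 := by gcongr
  nlinarith [mul_nonneg hk0 (sq_nonneg a)]

theorem lyap (n : ℕ) : ∀ (V : Type) [NormedAddCommGroup V] [NormedSpace ℂ V]
    [FiniteDimensional ℂ V] (A : V →ₗ[ℂ] V), Module.finrank ℂ V = n →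
    (∀ (l : ℂ) (v : V), v ≠ 0 → A v = l • v → l.re ≠ 0) →
    ∃ (B : V →L[ℝ] V →L[ℝ] ℝ) (κ : ℝ), 0 < κ ∧ (∀ x y, B x y = B y x) ∧
      ∀ x, κ * ‖x‖ ^ 2 ≤ B x (A x) := by
  induction n with
  | zero =>
    intro V _ _ _ A hn _
    have : Subsingleton V := Module.finrank_zero_iff.1 hn
    refine ⟨0, 1, one_pos, by simp, fun x => ?_⟩
    simp [Subsingleton.elim x 0]
  | succ n ih =>
    intro V _ _ _ A hn hA
    have : Nontrivial V := Module.nontrivial_of_finrank_pos (R := ℂ) (by omega)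
    obtain ⟨l, hl⟩ := Module.End.exists_eigenvalue (K := ℂ) (V := Module.Dual ℂ V) A.dualMap
    obtain ⟨f, hf⟩ := hl.exists_hasEigenvector
    have hf0 : f ≠ 0 := hf.2
    have hfA : ∀ x, f (A x) = l * f x := by
      intro x
      have := hf.apply_eq_smul
      have := congrArg (fun g => g x) this
      simpa using this
    have hlre : l.re ≠ 0 := by
      by_contra hcon
      have hinj : Function.Injective (A - l • LinearMap.id : V →ₗ[ℂ] V) := by
        rw [injective_iff_map_eq_zero]
        intro v hv
        by_contra hv0
        exact hA l v hv0 (by simpa [sub_eq_zero] using hv) hcon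
      have hsur := LinearMap.injective_iff_surjective.1 hinj
      apply hf0
      ext y
      obtain ⟨x, rfl⟩ := hsur y
      simp [hfA]
    obtain ⟨e₀, he₀⟩ : ∃ e, f e ≠ 0 := by
      by_contra! h
      exact hf0 (LinearMap.ext h)
    obtain ⟨e, he⟩ : ∃ e, f e = 1 := ⟨(f e₀)⁻¹ • e₀, by simp [he₀]⟩
    let W := LinearMap.ker f
    have hWinv : ∀ w ∈ W, A w ∈ W := by
      intro w hw
      have hw' : f w = 0 := hw
      change f (A w) = 0
      rw [hfA, hw', mul_zero]
    let AW : W →ₗ[ℂ] W := A.restrict hWinv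
    have hdim : Module.finrank ℂ W = n := by
      have h1 := LinearMap.finrank_range_add_finrank_ker f
      have h2 : LinearMap.range f = ⊤ := LinearMap.range_eq_top.2 (by
        intro c; exact ⟨c • e, by simp [he]⟩)
      rw [h2, finrank_top, Module.finrank_self, hn] at h1
      change Module.finrank ℂ (LinearMap.ker f) = n
      omega
    obtain ⟨BW, κ, hκ, hsymm, hBW⟩ := ih W AW hdim (by
      intro l v hv h
      refine hA l v.1 (by simpa using hv) ?_
      exact congrArg Subtype.val h)
    let P₀ : V →ₗ[ℂ] W := (LinearMap.id - f.smulRight e).codRestrict W (by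
      intro x; change f _ = 0; simp [he])
    have hP₀ : ∀ x, (P₀ x : V) = x - f x • e := fun x => rfl
    let P : V →L[ℝ] W := (LinearMap.toContinuousLinearMap P₀).restrictScalars ℝ
    let fc : V →L[ℝ] ℂ := (LinearMap.toContinuousLinearMap f).restrictScalars ℝ
    have hP : ∀ x, P x = P₀ x := fun x => rfl
    have hfc : ∀ x, fc x = f x := fun x => rfl
    have hPA : ∀ x, P (A x) = AW (P x) + f x • P (A e) := by
      intro x
      apply Subtype.ext
      simp [hP, hP₀, AW, hfA, he, smul_sub, sub_smul]
      module
    let s : ℝ := SignType.sign l.re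
    have hs : s * l.re = |l.re| := by simp [s, sign_mul_self]
    let C : ℝ := ‖BW‖ * ‖P (A e)‖
    let N : ℝ := (C ^ 2 / (2 * κ) + 1) / |l.re|
    have hm : 0 < |l.re| := abs_pos.2 hlre
    have hN : N * |l.re| = C ^ 2 / (2 * κ) + 1 := by
      simp only [N]; field_simp
    let fr : V →L[ℝ] ℝ := Complex.reCLM.comp fc
    let fi : V →L[ℝ] ℝ := Complex.imCLM.comp fc
    have hfr : ∀ x, fr x = (f x).re := fun x => rfl
    have hfi : ∀ x, fi x = (f x).im := fun x => rfl
    let D : V →L[ℝ] V →L[ℝ] ℝ := (ContinuousLinearMap.mul ℝ ℝ).bilinearComp fr fr +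
      (ContinuousLinearMap.mul ℝ ℝ).bilinearComp fi fi
    have hD : ∀ x y, D x y = (f x).re * (f y).re + (f x).im * (f y).im := fun x y => rfl
    have happ : ∀ x y, (BW.bilinearComp P P + (N * s) • D) x y = BW (P x) (P y) + N * s * D x y :=
      fun x y => rfl
    refine ⟨BW.bilinearComp P P + (N * s) • D,
      min (κ / 4) (1 / (2 * (‖e‖ ^ 2 + 1))), by positivity, ?_, ?_⟩
    · intro x y
      rw [happ, happ, hD, hD, hsymm (P x) (P y)]
      ring
    · intro x
      have hX : ‖x‖ ≤ ‖P x‖ + ‖f x‖ * ‖e‖ := by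
        have : x = (P x : V) + f x • e := by simp [hP, hP₀]
        calc ‖x‖ = ‖(P x : V) + f x • e‖ := by rw [← this]
          _ ≤ _ := (norm_add_le _ _).trans (by rw [norm_smul]; rfl)
      refine (lyap_arith hκ (norm_nonneg x) hX hN).trans ?_
      have e1 : D x (A x) = l.re * ‖f x‖ ^ 2 := by
        rw [hD, hfA, ← Complex.normSq_eq_norm_sq, Complex.normSq_apply]
        simp; ring
      have e2 : -(C * ‖f x‖ * ‖P x‖) ≤ BW (P x) (f x • P (A e)) := by
        have h := BW.le_opNorm₂ (P x) (f x • P (A e))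
        rw [norm_smul] at h
        have h' := neg_abs_le (BW (P x) (f x • P (A e)))
        rw [Real.norm_eq_abs] at h
        simp only [C]
        linarith
      have e3 := hBW (P x)
      rw [happ, hPA, map_add, e1]
      have e4 : N * s * (l.re * ‖f x‖ ^ 2) = N * |l.re| * ‖f x‖ ^ 2 := by rw [← hs]; ring
      rw [e4]
      linarith

theorem chetaev {E : Type*} [NormedAddCommGroup E] [NormedSpace ℝ E] [CompleteSpace E]
    (F : E → E) (hF : ContDiff ℝ 1 F) (K : NNReal) (hL : LipschitzWith K F) (h0 : F 0 = 0)
    (M : E →L[ℝ] E) (hM : HasFDerivAt F M 0)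
    (B : E →L[ℝ] E →L[ℝ] ℝ) (hB : ∀ x y, B x y = B y x) (κ c : ℝ) (hκ : 0 < κ) (hc : 0 < c)
    (hpos : ∀ x, κ * ‖x‖ ^ 2 ≤ B x (M x - c • x)) (x₀ : E) (hx₀ : 0 < B x₀ x₀) :
    ∃ ε > (0 : ℝ), ∀ δ' > (0 : ℝ), ∃ Z : ℝ → E,
      (∀ t : ℝ, 0 ≤ t → HasDerivAt Z (F (Z t)) t) ∧ ‖Z 0‖ < δ' ∧
        ∃ t : ℝ, 0 ≤ t ∧ ε ≤ ‖Z t‖ := by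
  have hη : 0 < κ / (‖B‖ + 1) := by positivity
  have hlo := hM.isLittleO.def hη
  rw [Metric.eventually_nhds_iff] at hlo
  obtain ⟨ε, hε, hlo⟩ := hlo
  have hR : ∀ z, ‖z‖ < ε → c * B z z ≤ B z (F z) := by
    intro z hz
    have h1 : ‖F z - M z‖ ≤ κ / (‖B‖ + 1) * ‖z‖ := by
      have := @hlo z (by simpa using hz)
      simpa [h0] using this
    have h2 : |B z (F z - M z)| ≤ κ * ‖z‖ ^ 2 := by
      calc |B z (F z - M z)| ≤ ‖B‖ * ‖z‖ * ‖F z - M z‖ := B.le_opNorm₂ _ _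
        _ ≤ (‖B‖ + 1) * ‖z‖ * (κ / (‖B‖ + 1) * ‖z‖) := by gcongr; linarith
        _ = κ * ‖z‖ ^ 2 := by field_simp
    have h3 := hpos z
    simp only [map_sub, map_smul, smul_eq_mul] at h2 h3
    have := neg_abs_le ((B z) (F z) - (B z) (M z))
    linarith
  refine ⟨ε, hε, fun δ' hδ' => ?_⟩
  let s : ℝ := δ' / (2 * (‖x₀‖ + 1))
  have hs : 0 < s := by positivity
  obtain ⟨Z, hZ0, hZ⟩ := global_sol F hF K hL h0 (s • x₀)
  refine ⟨Z, fun t _ => hZ t, ?_, ?_⟩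
  · rw [hZ0, norm_smul, Real.norm_of_nonneg hs.le]
    simp only [s]
    rw [div_mul_eq_mul_div, div_lt_iff₀ (by positivity)]
    nlinarith [norm_nonneg x₀]
  · by_contra! hcon
    let g : ℝ → ℝ := fun t => B (Z t) (Z t)
    have hg : ∀ t, HasDerivAt g (2 * B (Z t) (F (Z t))) t := by
      intro t
      have h1 : HasDerivAt (fun t => B (Z t)) (B (F (Z t))) t :=
        B.hasFDerivAt.comp_hasDerivAt t (hZ t)
      have h2 := h1.clm_apply (hZ t)
      refine h2.congr_deriv ?_
      rw [hB (F (Z t)) (Z t)]; ring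
    let w : ℝ → ℝ := fun t => Real.exp (-(2 * c) * t) * g t
    have hw : ∀ t, HasDerivAt w (Real.exp (-(2 * c) * t) *
        (2 * (B (Z t) (F (Z t)) - c * g t))) t := by
      intro t
      have h1 : HasDerivAt (fun t : ℝ => Real.exp (-(2 * c) * t))
          (Real.exp (-(2 * c) * t) * (-(2 * c))) t := by
        have := ((hasDerivAt_id t).const_mul (-(2 * c))).exp
        simpa using this
      refine (h1.mul (hg t)).congr_deriv ?_
      ring
    have hmono : MonotoneOn w (Set.Ici 0) := by
      apply monotoneOn_of_deriv_nonneg (convex_Ici 0)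
        (fun t _ => (hw t).continuousAt.continuousWithinAt)
        (fun t _ => (hw t).differentiableAt.differentiableWithinAt)
      intro t ht
      rw [interior_Ici, Set.mem_Ioi] at ht
      rw [(hw t).deriv]
      have := hR (Z t) (hcon t ht.le)
      have h2 : 0 ≤ B (Z t) (F (Z t)) - c * g t := by simp only [g]; linarith
      positivity
    have hg0 : 0 < g 0 := by
      simp only [g, hZ0, map_smul, _root_.smul_apply, smul_eq_mul]
      positivity
    have hub : ∀ t, 0 ≤ t → g 0 ≤ Real.exp (-(2 * c) * t) * (‖B‖ * ε * ε) := by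
      intro t ht
      have h1 := hmono (Set.mem_Ici.2 le_rfl) (Set.mem_Ici.2 ht) ht
      have h2 : w 0 = g 0 := by simp [w]
      have h3 : g t ≤ ‖B‖ * ε * ε := by
        have hz := (hcon t ht).le
        calc g t ≤ |B (Z t) (Z t)| := le_abs_self _
          _ ≤ ‖B‖ * ‖Z t‖ * ‖Z t‖ := B.le_opNorm₂ _ _
          _ ≤ _ := by gcongr
      rw [h2] at h1
      refine h1.trans ?_
      simp only [w]
      gcongr
    have hlim : Filter.Tendsto (fun t : ℝ => Real.exp (-(2 * c) * t) * (‖B‖ * ε * ε))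
        Filter.atTop (nhds (0 * (‖B‖ * ε * ε))) := by
      apply Filter.Tendsto.mul_const
      apply Real.tendsto_exp_atBot.comp
      exact Filter.tendsto_id.const_mul_atTop_of_neg (by linarith)
    rw [zero_mul] at hlim
    have := ge_of_tendsto hlim (Filter.eventually_atTop.2 ⟨0, hub⟩)
    linarith

theorem exists_form {ι : Type} [Fintype ι] [DecidableEq ι] (M : Matrix ι ι ℝ) (ν : ℂ)
    (v : ι → ℂ) (hv : v ≠ 0) (hMv : (M.map Complex.ofReal) *ᵥ v = ν • v) (hν : 0 < ν.re) :
    ∃ (B : (ι → ℝ) →L[ℝ] (ι → ℝ) →L[ℝ] ℝ) (κ c : ℝ) (x₀ : ι → ℝ),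
      (∀ x y, B x y = B y x) ∧ 0 < κ ∧ 0 < c ∧
      (∀ x, κ * ‖x‖ ^ 2 ≤ B x (M *ᵥ x - c • x)) ∧ 0 < B x₀ x₀ := by
  let A₀ : (ι → ℂ) →ₗ[ℂ] (ι → ℂ) := (M.map Complex.ofReal).mulVecLin
  have hfin : Set.Finite (Set.image Complex.re {μ | Module.End.HasEigenvalue A₀ μ}) :=
    (Module.End.finite_hasEigenvalue A₀).image _
  obtain ⟨c, ⟨hc0, hc1⟩, hc⟩ : ∃ c ∈ Set.Ioo 0 ν.re,
      c ∉ Set.image Complex.re {μ | Module.End.HasEigenvalue A₀ μ} :=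
    (Set.Ioo_infinite hν).exists_notMem_finite hfin
  obtain ⟨B, κ, hκ, hsymm, hB⟩ := lyap _ (ι → ℂ) (A₀ - (c : ℂ) • LinearMap.id) rfl (by
    intro l w hw h hl
    apply hc
    refine ⟨l + c, ?_, by simp [hl]⟩
    apply Module.End.hasEigenvalue_of_hasEigenvector (x := w)
    rw [Module.End.hasEigenvector_iff]
    refine ⟨?_, hw⟩
    rw [Module.End.mem_eigenspace_iff, add_smul, ← h]
    simp)
  let J : (ι → ℝ) →L[ℝ] (ι → ℂ) :=
    ContinuousLinearMap.pi (fun i => Complex.ofRealCLM.comp (ContinuousLinearMap.proj i))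
  have hJ : ∀ x i, J x i = (x i : ℂ) := fun x i => rfl
  have hJn : ∀ x, ‖x‖ ≤ ‖J x‖ := by
    intro x
    rw [pi_norm_le_iff_of_nonneg (norm_nonneg _)]
    intro i
    have := norm_le_pi_norm (J x) i
    simpa [hJ] using this
  have hJM : ∀ x, J (M *ᵥ x - c • x) =
      (A₀ - (c : ℂ) • LinearMap.id : (ι → ℂ) →ₗ[ℂ] (ι → ℂ)) (J x) := by
    intro x
    ext i
    simp [hJ, A₀, Matrix.mulVec, dotProduct]
  let B' := B.bilinearComp J J
  have hB's : ∀ x y, B' x y = B' y x := fun x y => hsymm _ _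
  have hB' : ∀ x, κ * ‖x‖ ^ 2 ≤ B' x (M *ᵥ x - c • x) := by
    intro x
    change _ ≤ B (J x) (J _)
    rw [hJM]
    refine le_trans ?_ (hB (J x))
    have := hJn x
    gcongr
  let x : ι → ℝ := fun i => (v i).re
  let y : ι → ℝ := fun i => (v i).im
  have hx : M *ᵥ x = ν.re • x - ν.im • y := by
    ext i
    have := congrArg Complex.re (congrFun hMv i)
    simpa [Matrix.mulVec, dotProduct, x, y] using this
  have hy : M *ᵥ y = ν.re • y + ν.im • x := by
    ext i
    have := congrArg Complex.im (congrFun hMv i)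
    simpa [Matrix.mulVec, dotProduct, x, y, add_comm] using this
  have h1 := hB' x
  have h2 := hB' y
  rw [hx] at h1
  rw [hy] at h2
  simp only [map_sub, map_add, map_smul, smul_eq_mul] at h1 h2
  have h3 := hB's x y
  have h4 : 0 < ‖x‖ ^ 2 + ‖y‖ ^ 2 := by
    by_contra! hle
    have hx0 : x = 0 := by
      rw [← norm_eq_zero]; nlinarith [sq_nonneg ‖x‖, sq_nonneg ‖y‖]
    have hy0 : y = 0 := by
      rw [← norm_eq_zero]; nlinarith [sq_nonneg ‖x‖, sq_nonneg ‖y‖]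
    apply hv
    ext i
    exact Complex.ext (congrFun hx0 i) (congrFun hy0 i)
  have h5 : 0 < (ν.re - c) * (B' x x + B' y y) := by
    have : 0 < κ * (‖x‖ ^ 2 + ‖y‖ ^ 2) := by positivity
    rw [h3] at h1
    linarith
  have h6 : 0 < B' x x + B' y y := pos_of_mul_pos_right h5 (by linarith)
  rcases lt_or_ge 0 (B' x x) with h | h
  · exact ⟨B', κ, c, x, hB's, hκ, hc0, hB', h⟩
  · exact ⟨B', κ, c, y, hB's, hκ, hc0, hB', by linarith⟩


theorem lip_add {E : Type*} [NormedAddCommGroup E] {f g : E → ℝ}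
    (hf : ∃ K, LipschitzWith K f) (hg : ∃ K, LipschitzWith K g) :
    ∃ K, LipschitzWith K (fun x => f x + g x) := by
  obtain ⟨K, hK⟩ := hf
  obtain ⟨K', hK'⟩ := hg
  exact ⟨_, hK.add hK'⟩

theorem lip_mul {E : Type*} [NormedAddCommGroup E] {f : E → ℝ} (c : ℝ)
    (hf : ∃ K, LipschitzWith K f) : ∃ K, LipschitzWith K (fun x => c * f x) := by
  obtain ⟨K, hK⟩ := hf
  exact ⟨_, (lipschitzWith_smul c).comp hK⟩

theorem lip_sum {E : Type*} [NormedAddCommGroup E] {κ : Type*} (s : Finset κ) {f : κ → E → ℝ}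
    (hf : ∀ i, ∃ K, LipschitzWith K (f i)) : ∃ K, LipschitzWith K (fun x => ∑ i ∈ s, f i x) := by
  classical
  induction s using Finset.induction_on with
  | empty => exact ⟨0, by simpa using LipschitzWith.const (0 : ℝ)⟩
  | insert a s ha ih =>
    simp only [Finset.sum_insert ha]
    exact lip_add (hf a) ih

theorem lip_pi {E : Type*} [NormedAddCommGroup E] {κ : Type*} [Fintype κ] {f : E → κ → ℝ}
    (hf : ∀ i, ∃ K, LipschitzWith K (fun x => f x i)) : ∃ K, LipschitzWith K f := by
  choose K hK using hf
  refine ⟨∑ i, K i, LipschitzWith.of_dist_le_mul fun x y => ?_⟩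
  rw [dist_pi_le_iff (by positivity)]
  intro i
  refine ((hK i).dist_le_mul x y).trans ?_
  gcongr
  exact Finset.single_le_sum (f := K) (fun i _ => zero_le) (Finset.mem_univ i)

theorem lip_of_deriv {S : ℝ → ℝ} (hS : ContDiff ℝ 1 S) (hb : ∃ C, ∀ x, |deriv S x| ≤ C) :
    ∃ K, LipschitzWith K S := by
  obtain ⟨C, hC⟩ := hb
  refine ⟨C.toNNReal, lipschitzWith_of_nnnorm_deriv_le (hS.differentiable one_ne_zero) fun x => ?_⟩
  rw [← NNReal.coe_le_coe, coe_nnnorm, Real.norm_eq_abs]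
  exact (hC x).trans (Real.le_coe_toNNReal C)

/-- Linearization matrix of the belief dynamics at the origin. -/
def linMat {R : Type*} [CommRing R] {Na No : ℕ}
    (Aa : Matrix (Fin Na) (Fin Na) R) (Ao : Matrix (Fin No) (Fin No) R)
    (d u α γ β δ : R) : Matrix (Fin Na × Fin No) (Fin Na × Fin No) R :=
  fun p q => (-d + u * α) * (if p.1 = q.1 then 1 else 0) * (if p.2 = q.2 then 1 else 0)
    + u * γ * Aa p.1 q.1 * (if p.2 = q.2 then 1 else 0)
    + u * β * (if p.1 = q.1 then 1 else 0) * Ao p.2 q.2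
    + u * δ * Aa p.1 q.1 * Ao p.2 q.2

theorem linMat_mulVec {R : Type*} [CommRing R] {Na No : ℕ}
    (Aa : Matrix (Fin Na) (Fin Na) R) (Ao : Matrix (Fin No) (Fin No) R)
    (d u α γ β δ : R) (Z : Fin Na × Fin No → R) (p : Fin Na × Fin No) :
    (linMat Aa Ao d u α γ β δ *ᵥ Z) p = (-d + u * α) * Z p
      + u * γ * ∑ k, Aa p.1 k * Z (k, p.2) + u * β * ∑ l, Ao p.2 l * Z (p.1, l)
      + u * δ * ∑ l, Ao p.2 l * ∑ k, Aa p.1 k * Z (k, l) := by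
  simp only [Matrix.mulVec, dotProduct, linMat, Fintype.sum_prod_type, add_mul,
    Finset.sum_add_distrib]
  congr 1
  · congr 1
    · congr 1
      · have : ∀ x y, (-d * (if p.1 = x then 1 else 0) * (if p.2 = y then 1 else 0) * Z (x, y)
          + u * α * (if p.1 = x then 1 else 0) * (if p.2 = y then 1 else 0) * Z (x, y)) =
          if p.1 = x then (if p.2 = y then (-d + u * α) * Z (x, y) else 0) else 0 := by
          intro x y
          split_ifs <;> ring
        simp only [← Finset.sum_add_distrib, this]
        simp [add_mul]
      · simp [Finset.mul_sum, mul_assoc]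
    · simp [Finset.mul_sum, mul_assoc]
  · rw [Finset.sum_comm]
    simp only [Finset.mul_sum]
    refine Finset.sum_congr rfl fun l _ => Finset.sum_congr rfl fun k _ => ?_
    ring

theorem linMat_map {Na No : ℕ}
    (Aa : Matrix (Fin Na) (Fin Na) ℝ) (Ao : Matrix (Fin No) (Fin No) ℝ)
    (d u α γ β δ : ℝ) : (linMat Aa Ao d u α γ β δ).map Complex.ofReal =
      linMat (Aa.map Complex.ofReal) (Ao.map Complex.ofReal) (d : ℂ) u α γ β δ := by
  ext p q
  simp only [linMat, Matrix.map_apply]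
  push_cast
  simp only [apply_ite Complex.ofReal, Complex.ofReal_one, Complex.ofReal_zero]

theorem linMat_eigen {Na No : ℕ}
    (Aa : Matrix (Fin Na) (Fin Na) ℂ) (Ao : Matrix (Fin No) (Fin No) ℂ)
    (d u α γ β δ l m : ℂ) (v : Fin Na → ℂ) (w : Fin No → ℂ) (hv : Aa *ᵥ v = l • v)
    (hw : Ao *ᵥ w = m • w) :
    linMat Aa Ao d u α γ β δ *ᵥ (fun p => v p.1 * w p.2) =
      (-d + u * (α + γ * l + β * m + δ * l * m)) • (fun p => v p.1 * w p.2) := by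
  have hv' : ∀ i, ∑ k, Aa i k * v k = l * v i := fun i => congrFun hv i
  have hw' : ∀ i, ∑ k, Ao i k * w k = m * w i := fun i => congrFun hw i
  ext p
  rw [linMat_mulVec]
  have h1 : ∀ j, ∑ k, Aa p.1 k * (v k * w j) = l * v p.1 * w j := by
    intro j
    rw [← hv', Finset.sum_mul]
    exact Finset.sum_congr rfl fun k _ => by ring
  have h2 : ∀ c : ℂ, ∑ k, Ao p.2 k * (c * w k) = c * (m * w p.2) := by
    intro c
    rw [← hw', Finset.mul_sum]
    exact Finset.sum_congr rfl fun k _ => by ring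
  simp only [h1, h2, Pi.smul_apply, smul_eq_mul]
  ring

theorem exists_eigvec {n : ℕ} (M : Matrix (Fin n) (Fin n) ℝ) (l : ℂ) (hl : l ∈ specC M) :
    ∃ v : Fin n → ℂ, v ≠ 0 ∧ (M.map Complex.ofReal) *ᵥ v = l • v := by
  have h : Module.End.HasEigenvalue (Matrix.toLin' (M.map Complex.ofReal)) l := by
    rw [Module.End.hasEigenvalue_iff_isRoot_charpoly, Matrix.charpoly_toLin']
    exact hl
  obtain ⟨v, hv⟩ := h.exists_hasEigenvector
  exact ⟨v, hv.2, by simpa using hv.apply_eq_smul⟩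

theorem sum_erase_zero {n : ℕ} (i : Fin n) (f : Fin n → ℝ) (hf : f i = 0) :
    ∑ k ∈ Finset.univ.erase i, f k = ∑ k, f k :=
  Finset.sum_erase _ hf

/-- Instability part of Lemma 1: if `K > 0` and `u > u* = d/K`, the neutral equilibrium
`Z = 0` of the belief dynamics is unstable. -/
theorem origin_unstable {Na No : ℕ} (hNa : 1 ≤ Na) (hNo : 1 ≤ No)
    (Aa : Matrix (Fin Na) (Fin Na) ℝ) (Ao : Matrix (Fin No) (Fin No) ℝ)
    (hAa : ∀ i, Aa i i = 0) (hAo : ∀ j, Ao j j = 0)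
    (d u α γ β δ K : ℝ) (hd : 0 < d) (hu : 0 ≤ u)
    (S₁ S₂ : ℝ → ℝ)
    (hS₁smooth : ContDiff ℝ 1 S₁) (hS₂smooth : ContDiff ℝ 1 S₂)
    (hS₁bdd : ∃ C, ∀ x, |S₁ x| ≤ C) (hS₂bdd : ∃ C, ∀ x, |S₂ x| ≤ C)
    (hS₁dbdd : ∃ C, ∀ x, |deriv S₁ x| ≤ C) (hS₂dbdd : ∃ C, ∀ x, |deriv S₂ x| ≤ C)
    (hS₁0 : S₁ 0 = 0) (hS₂0 : S₂ 0 = 0)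
    (hS₁1 : deriv S₁ 0 = 1) (hS₂1 : deriv S₂ 0 = 1)
    (hK : IsGreatest {x : ℝ | ∃ l ∈ specC Aa, ∃ m ∈ specC Ao,
        x = ((α : ℂ) + (γ : ℂ) * l + (β : ℂ) * m + (δ : ℂ) * l * m).re} K)
    (hKpos : 0 < K) (hu' : u > d / K) :
    ∃ ε > (0 : ℝ), ∀ δ' > (0 : ℝ),
      ∃ Z : ℝ → (Fin Na × Fin No → ℝ),
        (∀ t : ℝ, 0 ≤ t → HasDerivAt Z (beliefField Aa Ao d u α γ β δ S₁ S₂ (Z t)) t) ∧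
        ‖Z 0‖ < δ' ∧ ∃ t : ℝ, 0 ≤ t ∧ ε ≤ ‖Z t‖ := by
  obtain ⟨⟨l, hl, m, hm, hKeq⟩, -⟩ := hK
  obtain ⟨v, hv0, hv⟩ := exists_eigvec Aa l hl
  obtain ⟨w, hw0, hw⟩ := exists_eigvec Ao m hm
  have heig := linMat_eigen _ _ (d : ℂ) u α γ β δ l m v w hv hw
  rw [← linMat_map] at heig
  have hvw : (fun p : Fin Na × Fin No => v p.1 * w p.2) ≠ 0 := by
    obtain ⟨i, hi⟩ := Function.ne_iff.1 hv0
    obtain ⟨j, hj⟩ := Function.ne_iff.1 hw0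
    exact Function.ne_iff.2 ⟨(i, j), mul_ne_zero hi hj⟩
  have hre : 0 < (-(d : ℂ) + u * (α + γ * l + β * m + δ * l * m)).re := by
    rw [Complex.add_re, Complex.re_ofReal_mul, ← hKeq, Complex.neg_re, Complex.ofReal_re]
    have := (div_lt_iff₀ hKpos).1 hu'
    linarith
  obtain ⟨B, κ, c, x₀, hBs, hκ, hc, hpos, hx₀⟩ := exists_form _ _ _ hvw heig hre
  let pr : Fin Na × Fin No → (Fin Na × Fin No → ℝ) →L[ℝ] ℝ := fun p => ContinuousLinearMap.proj p
  let g : Fin Na × Fin No → (Fin Na × Fin No → ℝ) →L[ℝ] ℝ := fun p =>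
    α • pr p + γ • ∑ k, Aa p.1 k • pr (k, p.2)
  let h : Fin Na × Fin No → Fin No → (Fin Na × Fin No → ℝ) →L[ℝ] ℝ := fun p l =>
    (β * Ao p.2 l) • pr (p.1, l) + (δ * Ao p.2 l) • ∑ k, Aa p.1 k • pr (k, l)
  have hg : ∀ p Z, g p Z = α * Z p + γ * ∑ k, Aa p.1 k * Z (k, p.2) := by
    intro p Z
    simp [g, pr]
  have hh : ∀ p l Z, h p l Z = β * Ao p.2 l * Z (p.1, l)
      + δ * Ao p.2 l * ∑ k, Aa p.1 k * Z (k, l) := by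
    intro p l Z
    simp [h, pr]
  have hFeq : beliefField Aa Ao d u α γ β δ S₁ S₂ = fun Z p =>
      -d * pr p Z + u * (S₁ (g p Z) + ∑ l, S₂ (h p l Z)) := by
    funext Z p
    simp only [beliefField, hg, hh]
    have e1 : ∀ j, ∑ k ∈ Finset.univ.erase p.1, Aa p.1 k * Z (k, j) = ∑ k, Aa p.1 k * Z (k, j) :=
      fun j => sum_erase_zero _ _ (by simp [hAa])
    simp only [e1]
    rw [sum_erase_zero p.2 _ (by simp [hAo, hS₂0])]
    rfl
  have hd₁ : ∀ p, HasFDerivAt (fun Z => S₁ (g p Z)) (g p) 0 := by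
    intro p
    have h1 : HasDerivAt S₁ 1 (g p 0) := by
      rw [map_zero, ← hS₁1]
      exact (hS₁smooth.differentiable one_ne_zero 0).hasDerivAt
    refine (h1.comp_hasFDerivAt 0 (g p).hasFDerivAt).congr_fderiv ?_
    simp
  have hd₂ : ∀ p l, HasFDerivAt (fun Z => S₂ (h p l Z)) (h p l) 0 := by
    intro p l
    have h1 : HasDerivAt S₂ 1 (h p l 0) := by
      rw [map_zero, ← hS₂1]
      exact (hS₂smooth.differentiable one_ne_zero 0).hasDerivAt
    refine (h1.comp_hasFDerivAt 0 (h p l).hasFDerivAt).congr_fderiv ?_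
    simp
  have hM : HasFDerivAt (beliefField Aa Ao d u α γ β δ S₁ S₂)
      (LinearMap.toContinuousLinearMap (linMat Aa Ao d u α γ β δ).mulVecLin) 0 := by
    rw [hFeq, hasFDerivAt_pi']
    intro p
    have h1 := ((pr p).hasFDerivAt (x := 0)).const_mul (-d)
    have h2 := ((hd₁ p).add (HasFDerivAt.fun_sum (u := Finset.univ)
      (fun l _ => hd₂ p l))).const_mul u
    refine (h1.add h2).congr_fderiv ?_
    ext1 Z
    have e : ∀ Z, (-d • pr p + u • (g p + ∑ l, h p l)) Z =
      -d * Z p + u * (g p Z + ∑ l, h p l Z) := by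
      intro Z
      simp [pr]
      ring
    rw [e]
    change _ = (linMat Aa Ao d u α γ β δ *ᵥ Z) p
    rw [linMat_mulVec, hg]
    simp only [hh, Finset.sum_add_distrib, mul_assoc, ← Finset.mul_sum]
    ring
  have hC : ContDiff ℝ 1 (beliefField Aa Ao d u α γ β δ S₁ S₂) := by
    rw [hFeq, contDiff_pi]
    intro p
    have h1 : ContDiff ℝ 1 (fun Z => S₁ (g p Z)) := hS₁smooth.comp (g p).contDiff
    have h2 : ∀ l, ContDiff ℝ 1 (fun Z => S₂ (h p l Z)) :=
      fun l => hS₂smooth.comp (h p l).contDiff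
    exact (contDiff_const.mul (pr p).contDiff).add
      (contDiff_const.mul (h1.add (ContDiff.sum fun l _ => h2 l)))
  obtain ⟨L, hL⟩ : ∃ L, LipschitzWith L (beliefField Aa Ao d u α γ β δ S₁ S₂) := by
    rw [hFeq]
    obtain ⟨L₁, hL₁⟩ := lip_of_deriv hS₁smooth hS₁dbdd
    obtain ⟨L₂, hL₂⟩ := lip_of_deriv hS₂smooth hS₂dbdd
    apply lip_pi
    intro p
    exact lip_add (lip_mul _ ⟨_, (pr p).lipschitz⟩) (lip_mul _ (lip_add
      ⟨_, hL₁.comp (g p).lipschitz⟩ (lip_sum _ fun l => ⟨_, hL₂.comp (h p l).lipschitz⟩)))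
  have hF0 : beliefField Aa Ao d u α γ β δ S₁ S₂ 0 = 0 := by
    rw [hFeq]
    funext p
    simp [hS₁0, hS₂0]
  exact chetaev _ hC L hL hF0 _ hM B hBs κ c hκ hc hpos x₀ hx₀
end
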